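/- Let C be a category with pullbacks, m : x ⟶ c a monomorphism, and T the sieve on c generated by m. Let r : d ⟶ c be a morphism such that the pullback of r along any morphism f : b ⟶ c (i.e., the projection pullback(r, f) ⟶ b) is a strong epimorphism. Then for every sieve R on c, the pullback sieve r*(R) is contained in r*(T) if and only if R is contained in T. -/

import Mathlib

open CategoryTheory CategoryTheory.Limits

/-- Let `T` be the sieve generated by a monomorphism `m : x ⟶ c`, and let `r : d ⟶ c` be a
morphism whose pullback along any morphism into `c` is a strong epimorphism. Then for every
sieve `R` on `c`, `r*(R) ≤ r*(T)` if and only if `R ≤ T`. -/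
theorem pullback_le_pullback_generate_mono_iff
    {C : Type u} [Category.{v} C] [HasPullbacks C]
    {x c d : C} (m : x ⟶ c) [Mono m] (r : d ⟶ c)
    (hr : ∀ {b : C} (f : b ⟶ c), StrongEpi (pullback.snd r f))
    (R : Sieve c) :
    R.pullback r ≤ (Sieve.generate (Presieve.singleton m)).pullback r ↔
      R ≤ Sieve.generate (Presieve.singleton m) := by
  constructor
  · intro h b f hf
    have h1 : (R.pullback r) (pullback.fst r f) := by
      change R (pullback.fst r f ≫ r)
      rw [pullback.condition]
      exact R.downward_closed hf _
    obtain ⟨_, k, _, ⟨⟩, hk⟩ := h _ h1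
    have := hr f
    have sq : CommSq k (pullback.snd r f) m f := ⟨by rw [hk, pullback.condition]⟩
    exact ⟨x, sq.lift, m, ⟨⟩, sq.fac_right⟩
  · intro h
    exact Sieve.pullback_monotone r h
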